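/- arXiv:1510.03216 — 5 statements merged into one kernel-verified Lean document; each statement's English description precedes it below -/
import Mathlib

section
/- Let r_1, …, r_{n−1} ∈ F_n and let a : F_n → ℤ be a group homomorphism with a(r_i) = 0 for all i. Let A be the (n−1)×n matrix over ℤ[t, t⁻¹] with entries A_{ij} = α_*(∂r_i/∂x_j), and for each k let A_k be the (n−1)×(n−1) matrix obtained from A by removing the k-th column. Then for all k, l ∈ {1, …, n} one has, up to sign, (α_*(x_l) − 1)·det A_k = ± (α_*(x_k) − 1)·det A_l; that is, either (α_*(x_l) − 1)·det A_k = (α_*(x_k) − 1)·det A_l or (α_*(x_l) − 1)·det A_k = −(α_*(x_k) − 1)·det A_l. -/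
/-- The canonical inclusion of the free group on `Fin (n+1)` into its integral group ring. -/
noncomputable def ofF (n : ℕ) : FreeGroup (Fin (n + 1)) →* MonoidAlgebra ℤ (FreeGroup (Fin (n + 1))) :=
  MonoidAlgebra.of ℤ (FreeGroup (Fin (n + 1)))

/-- If the kernel of an `n × (n + 1)` matrix contains `c`, then its signed maximal minors are
proportional to the entries of `c`. -/
theorem Matrix.mul_det_submatrix_succAbove_of_mulVec_eq_zero {R : Type*} [CommRing R] {n : ℕ}
    (B : Matrix (Fin n) (Fin (n + 1)) R) (c : Fin (n + 1) → R) (hc : B.mulVec c = 0)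
    (k l : Fin (n + 1)) :
    c l * ((-1) ^ (k : ℕ) * (B.submatrix id k.succAbove).det) =
      c k * ((-1) ^ (l : ℕ) * (B.submatrix id l.succAbove).det) := by
  let M : Matrix (Fin (n + 1)) (Fin (n + 1)) R :=
    Matrix.of (Fin.cons (Pi.single k 1) B)
  have hM0 : M 0 = Pi.single k 1 := rfl
  have hMs (i : Fin n) : M i.succ = B i := rfl
  have hsub (m : Fin (n + 1)) : M.submatrix Fin.succ m.succAbove = B.submatrix id m.succAbove := rfl
  have hM : M.mulVec c = Pi.single 0 (c k) := by
    ext i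
    refine Fin.cases ?_ (fun i => ?_) i
    · simp [Matrix.mulVec, hM0]
    · simpa [Matrix.mulVec, hMs] using congrFun hc i
  have hdet : M.det = (-1) ^ (k : ℕ) * (B.submatrix id k.succAbove).det := by
    rw [Matrix.det_succ_row_zero, Finset.sum_eq_single k]
    · rw [hsub]
      simp [hM0]
    · intro j _ hj
      simp [hM0, hj]
    · simp
  have hadj : M.adjugate.mulVec (M.mulVec c) = M.det • c := by
    rw [Matrix.mulVec_mulVec, Matrix.adjugate_mul, Matrix.smul_mulVec, Matrix.one_mulVec]
  have := congrFun hadj l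
  rw [hM, Matrix.mulVec_single, hdet] at this
  simp only [Pi.smul_apply, smul_eq_mul, Matrix.col_apply, MulOpposite.smul_eq_mul_unop,
    MulOpposite.unop_op, Matrix.adjugate_fin_succ_eq_det_submatrix, Fin.succAbove_zero, hsub,
    Fin.val_zero, zero_add] at this
  rw [mul_comm, ← this, mul_comm]

/-- The fundamental formula of Fox calculus, pushed forward along a ring homomorphism. -/
theorem sum_map_fox_mul_map_of_sub_one {S : Type*} [Ring S] (n : ℕ)
    (D : Fin (n + 1) →
      (MonoidAlgebra ℤ (FreeGroup (Fin (n + 1))) →ₗ[ℤ] MonoidAlgebra ℤ (FreeGroup (Fin (n + 1)))))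
    (hD1 : ∀ j i : Fin (n + 1), D j (ofF n (FreeGroup.of i)) = if i = j then 1 else 0)
    (hD2 : ∀ (j : Fin (n + 1)) (g g' : FreeGroup (Fin (n + 1))),
      D j (ofF n (g * g')) = D j (ofF n g) + ofF n g * D j (ofF n g'))
    (π : MonoidAlgebra ℤ (FreeGroup (Fin (n + 1))) →+* S) (g : FreeGroup (Fin (n + 1))) :
    ∑ j, π (D j (ofF n g)) * (π (ofF n (FreeGroup.of j)) - 1) = π (ofF n g) - 1 := by
  have hmul (g g' : FreeGroup (Fin (n + 1))) :
      ∑ j, π (D j (ofF n (g * g'))) * (π (ofF n (FreeGroup.of j)) - 1) =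
        ∑ j, π (D j (ofF n g)) * (π (ofF n (FreeGroup.of j)) - 1) +
        π (ofF n g) * ∑ j, π (D j (ofF n g')) * (π (ofF n (FreeGroup.of j)) - 1) := by
    simp only [hD2, map_add, map_mul π, add_mul, Finset.sum_add_distrib, Finset.mul_sum, mul_assoc]
  have hone : ∑ j, π (D j (ofF n 1)) * (π (ofF n (FreeGroup.of j)) - 1) = 0 := by
    simpa using hmul 1 1
  induction g using FreeGroup.induction_on with
  | C1 => rw [hone]; simp
  | of i => simp [hD1, apply_ite π]
  | inv_of i ih =>
    have h := hmul (FreeGroup.of i)⁻¹ (FreeGroup.of i)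
    rw [inv_mul_cancel, hone, ih, mul_sub, ← map_mul, ← map_mul, inv_mul_cancel, map_one,
      map_one, mul_one] at h
    rw [eq_neg_of_add_eq_zero_left h.symm, neg_sub]
  | mul x y hx hy =>
    rw [hmul, hx, hy, map_mul, map_mul]
    noncomm_ring

/-- For the Alexander matrix `A` of relators `r_1,…,r_n` in the free group on `n+1`
generators, with `A_k` the matrix obtained by deleting the `k`-th column, one has
`(α_*(x_l) - 1)·det A_k = ± (α_*(x_k) - 1)·det A_l`. -/
theorem alexander_matrix_det_relation (n : ℕ)
    (r : Fin n → FreeGroup (Fin (n + 1)))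
    (D : Fin (n + 1) →
      (MonoidAlgebra ℤ (FreeGroup (Fin (n + 1))) →ₗ[ℤ] MonoidAlgebra ℤ (FreeGroup (Fin (n + 1)))))
    (hD1 : ∀ j i : Fin (n + 1), D j (ofF n (FreeGroup.of i)) = if i = j then 1 else 0)
    (hD2 : ∀ (j : Fin (n + 1)) (g g' : FreeGroup (Fin (n + 1))),
      D j (ofF n (g * g')) = D j (ofF n g) + ofF n g * D j (ofF n g'))
    (a : FreeGroup (Fin (n + 1)) →* Multiplicative ℤ)
    (ha : ∀ i : Fin n, a (r i) = 1)
    (π : MonoidAlgebra ℤ (FreeGroup (Fin (n + 1))) →+* LaurentPolynomial ℤ)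
    (hπ : ∀ g : FreeGroup (Fin (n + 1)),
      π (ofF n g) = LaurentPolynomial.T (Multiplicative.toAdd (a g)))
    (k l : Fin (n + 1)) :
    let A : Fin (n + 1) → Matrix (Fin n) (Fin n) (LaurentPolynomial ℤ) :=
      fun m => Matrix.of fun i j => π (D (m.succAbove j) (ofF n (r i)))
    (π (ofF n (FreeGroup.of l)) - 1) * (A k).det = (π (ofF n (FreeGroup.of k)) - 1) * (A l).det ∨
    (π (ofF n (FreeGroup.of l)) - 1) * (A k).det =
      -((π (ofF n (FreeGroup.of k)) - 1) * (A l).det) := by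
  intro A
  let B : Matrix (Fin n) (Fin (n + 1)) (LaurentPolynomial ℤ) :=
    Matrix.of fun i j => π (D j (ofF n (r i)))
  have hB : B.mulVec (fun j => π (ofF n (FreeGroup.of j)) - 1) = 0 := by
    ext1 i
    have h := sum_map_fox_mul_map_of_sub_one n D hD1 hD2 π (r i)
    rw [hπ (r i), ha i, toAdd_one, LaurentPolynomial.T_zero, sub_self] at h
    exact h
  have h := Matrix.mul_det_submatrix_succAbove_of_mulVec_eq_zero B _ hB k l
  have hA (m : Fin (n + 1)) : B.submatrix id m.succAbove = A m := rfl
  rw [hA, hA] at h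
  rcases neg_one_pow_eq_or (LaurentPolynomial ℤ) (k : ℕ) with hk | hk <;>
    rcases neg_one_pow_eq_or (LaurentPolynomial ℤ) (l : ℕ) with hl | hl <;>
    rw [hk, hl] at h
  · left; linear_combination h
  · right; linear_combination h
  · right; linear_combination -h
  · left; linear_combination -h
end

section
/- Let 𝔽 be a field, r_1, …, r_{n−1} ∈ F_n, ρ : F_n → SL(2, 𝔽) a group homomorphism with ρ(r_i) = I for all i, and a : F_n → ℤ a group homomorphism with a(r_i) = 0 for all i. Let A_{ρ,k} be the 2(n−1)×2(n−1) matrix over 𝔽(t) whose (i, j) block (for j ≠ k) is the 2×2 matrix Φ(∂r_i/∂x_j). Then for all j, k ∈ {1, …, n} one has det(A_{ρ,k})·det(Φ(x_j) − I) = det(A_{ρ,j})·det(Φ(x_k) − I) in 𝔽(t), with no sign ambiguity. -/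
set_option synthInstance.maxHeartbeats 400000

section BlockMinors

open Matrix

/-- The bijection `(Fin n × β) ⊕ β ≃ Fin (n + 1) × β` placing the last block at position `m`. -/
def blockInsertEquiv (n : ℕ) (β : Type*) (m : Fin (n + 1)) :
    (Fin n × β) ⊕ β ≃ Fin (n + 1) × β :=
  ((Equiv.sumProdDistrib (Fin n) Unit β).trans
    (Equiv.sumCongr (Equiv.refl _) (Equiv.punitProd β))).symm.trans
    (Equiv.prodCongr ((finSuccEquiv' m).trans (Equiv.optionEquivSumPUnit.{0} (Fin n))).symm
      (Equiv.refl β))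

@[simp]
theorem blockInsertEquiv_inl (n : ℕ) (β : Type*) (m : Fin (n + 1)) (p : Fin n × β) :
    blockInsertEquiv n β m (Sum.inl p) = (m.succAbove p.1, p.2) := by
  simp [blockInsertEquiv]

@[simp]
theorem blockInsertEquiv_inr (n : ℕ) (β : Type*) (m : Fin (n + 1)) (b : β) :
    blockInsertEquiv n β m (Sum.inr b) = (m, b) := by
  simp [blockInsertEquiv]

/-- Permuting column blocks of width two does not change a determinant. -/
theorem det_submatrix_prodCongr_fin_two {R ι o : Type*} [CommRing R] [Fintype ι] [DecidableEq ι]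
    [Fintype o] [DecidableEq o] (M : Matrix o (ι × Fin 2) R) (e : o ≃ ι × Fin 2)
    (σ : Equiv.Perm ι) :
    (M.submatrix id (e.trans (Equiv.prodCongr σ (Equiv.refl _)))).det =
      (M.submatrix id e).det := by
  have hσ : Equiv.Perm.sign (Equiv.prodCongr σ (Equiv.refl (Fin 2))) = 1 := by
    have : Equiv.prodCongr σ (Equiv.refl (Fin 2)) = Equiv.prodCongrLeft fun _ => σ := by
      ext x <;> simp
    rw [this, Equiv.Perm.sign_prodCongrLeft]
    simp
  have h := det_permute' (Equiv.prodCongr σ (Equiv.refl (Fin 2))) (M.submatrix e.symm id)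
  rw [hσ] at h
  rw [← det_submatrix_equiv_self e.symm, ← det_submatrix_equiv_self e.symm (M.submatrix id e)]
  simpa [Function.comp_assoc] using h

theorem det_submatrix_blockInsertEquiv {R : Type*} [CommRing R] {n : ℕ}
    (M : Matrix ((Fin n × Fin 2) ⊕ Fin 2) (Fin (n + 1) × Fin 2) R) (j k : Fin (n + 1)) :
    (M.submatrix id (blockInsertEquiv n (Fin 2) j)).det =
      (M.submatrix id (blockInsertEquiv n (Fin 2) k)).det := by
  rw [← det_submatrix_prodCongr_fin_two M (blockInsertEquiv n (Fin 2) k)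
    ((finSuccEquiv' k).trans (finSuccEquiv' j).symm)]
  congr 2
  ext x <;> rcases x with x | x <;> simp

/-- If the `2 × 2` blocks `B i l` and `Y l` satisfy `∑ l, B i l * Y l = 0` for all `i`, then the
minors obtained from `B` by deleting a block column are proportional to the `det (Y l)`. -/
theorem det_blockMinor_mul_det {R : Type*} [CommRing R] {n : ℕ}
    (B : Fin n → Fin (n + 1) → Matrix (Fin 2) (Fin 2) R)
    (Y : Fin (n + 1) → Matrix (Fin 2) (Fin 2) R) (hBY : ∀ i, ∑ l, B i l * Y l = 0)
    (j k : Fin (n + 1)) :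
    (of fun p q : Fin n × Fin 2 => B p.1 (k.succAbove q.1) p.2 q.2).det * (Y j).det =
      (of fun p q : Fin n × Fin 2 => B p.1 (j.succAbove q.1) p.2 q.2).det * (Y k).det := by
  let b : Matrix (Fin n × Fin 2) (Fin (n + 1) × Fin 2) R := of fun p q => B p.1 q.1 p.2 q.2
  let u : Matrix (Fin 2) (Fin (n + 1) × Fin 2) R :=
    of fun p q => (if q.1 = k then (1 : Matrix (Fin 2) (Fin 2) R) else 0) p q.2
  let S : Matrix ((Fin n × Fin 2) ⊕ Fin 2) (Fin (n + 1) × Fin 2) R := fromRows b u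
  let Z : Matrix (Fin n × Fin 2) (Fin 2) R := of fun p q => Y (j.succAbove p.1) p.2 q
  have hk : (S.submatrix id (blockInsertEquiv n (Fin 2) k)).det =
      (of fun p q : Fin n × Fin 2 => B p.1 (k.succAbove q.1) p.2 q.2).det := by
    have : S.submatrix id (blockInsertEquiv n (Fin 2) k) =
        fromBlocks (of fun p q : Fin n × Fin 2 => B p.1 (k.succAbove q.1) p.2 q.2)
          (of fun p q => B p.1 k p.2 q) 0 1 := by
      ext p q
      rcases p with p | p <;> rcases q with q | q <;> simp [S, b, u]
    rw [this, det_fromBlocks_zero₂₁, det_one, mul_one]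
  have hj : S.submatrix id (blockInsertEquiv n (Fin 2) j) * fromBlocks 1 Z 0 (Y j) =
      fromBlocks (of fun p q : Fin n × Fin 2 => B p.1 (j.succAbove q.1) p.2 q.2) 0
        (of fun p q => u p (j.succAbove q.1, q.2)) (Y k) := by
    have hS : S.submatrix id (blockInsertEquiv n (Fin 2) j) =
        fromBlocks (of fun p q : Fin n × Fin 2 => B p.1 (j.succAbove q.1) p.2 q.2)
          (of fun p q => B p.1 j p.2 q) (of fun p q => u p (j.succAbove q.1, q.2))
          (of fun p q => u p (j, q)) := by
      ext p q
      rcases p with p | p <;> rcases q with q | q <;> simp [S, b]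
    have key : ∀ C : Fin (n + 1) → Matrix (Fin 2) (Fin 2) R, ∀ p q,
        ∑ x : Fin n × Fin 2, C (j.succAbove x.1) p x.2 * Y (j.succAbove x.1) x.2 q +
          ∑ x, C j p x * Y j x q = (∑ l, C l * Y l) p q := by
      intro C p q
      rw [Fin.sum_univ_succAbove _ j, Fintype.sum_prod_type, add_comm]
      simp [Matrix.add_apply, Matrix.sum_apply, Matrix.mul_apply]
    rw [hS, fromBlocks_multiply]
    congr 1
    · simp
    · ext p q
      simpa [hBY, Matrix.mul_apply, Z] using key (B p.1) p.2 q
    · simp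
    · have hu : ∑ l, (if l = k then (1 : Matrix (Fin 2) (Fin 2) R) else 0) * Y l = Y k := by
        simp
      ext p q
      rw [← hu, ← key]
      simp [Matrix.mul_apply, Z, u]
  have hdet := congrArg Matrix.det hj
  rwa [det_mul, det_fromBlocks_zero₂₁, det_one, one_mul, det_fromBlocks_zero₁₂,
    det_submatrix_blockInsertEquiv S j k, hk] at hdet

end BlockMinors

/-- The fundamental formula of the free differential calculus. -/
theorem sum_fox_mul_sub_one (n : ℕ)
    (D : Fin (n + 1) →
      (MonoidAlgebra ℤ (FreeGroup (Fin (n + 1))) →ₗ[ℤ] MonoidAlgebra ℤ (FreeGroup (Fin (n + 1)))))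
    (hD1 : ∀ j i : Fin (n + 1), D j (ofF n (FreeGroup.of i)) = if i = j then 1 else 0)
    (hD2 : ∀ (j : Fin (n + 1)) (g g' : FreeGroup (Fin (n + 1))),
      D j (ofF n (g * g')) = D j (ofF n g) + ofF n g * D j (ofF n g'))
    (w : FreeGroup (Fin (n + 1))) :
    ∑ l, D l (ofF n w) * (ofF n (FreeGroup.of l) - 1) = ofF n w - 1 := by
  have hmul : ∀ g g' : FreeGroup (Fin (n + 1)),
      ∑ l, D l (ofF n (g * g')) * (ofF n (FreeGroup.of l) - 1) =
        ∑ l, D l (ofF n g) * (ofF n (FreeGroup.of l) - 1) +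
          ofF n g * ∑ l, D l (ofF n g') * (ofF n (FreeGroup.of l) - 1) := by
    intro g g'
    simp only [hD2, add_mul, Finset.sum_add_distrib, Finset.mul_sum, mul_assoc]
  have hone : ∑ l, D l (ofF n 1) * (ofF n (FreeGroup.of l) - 1) = 0 := by
    simpa using hmul 1 1
  induction w using FreeGroup.induction_on with
  | C1 => rw [hone, map_one, sub_self]
  | of i => simp [hD1]
  | inv_of i h =>
    have h' := hmul (FreeGroup.of i)⁻¹ (FreeGroup.of i)
    rw [inv_mul_cancel, hone, h, mul_sub, ← map_mul, inv_mul_cancel, map_one, mul_one] at h'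
    rw [eq_neg_of_add_eq_zero_left h'.symm, neg_sub]
  | mul g g' h h' =>
    rw [hmul, h, h', map_mul, mul_sub, mul_one]
    abel

/-- For the twisted Alexander matrix of relators `r_1,…,r_n` in the free group on
`n + 1` generators, associated to `ρ : F_{n+1} → SL(2,𝔽)` and `a : F_{n+1} → ℤ`, one has
`det(A_{ρ,k})·det(Φ(x_j) - I) = det(A_{ρ,j})·det(Φ(x_k) - I)` with no sign ambiguity. -/
theorem twisted_alexander_det_relation (𝔽 : Type*) [Field 𝔽] (n : ℕ)
    (r : Fin n → FreeGroup (Fin (n + 1)))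
    (D : Fin (n + 1) →
      (MonoidAlgebra ℤ (FreeGroup (Fin (n + 1))) →ₗ[ℤ] MonoidAlgebra ℤ (FreeGroup (Fin (n + 1)))))
    (hD1 : ∀ j i : Fin (n + 1), D j (ofF n (FreeGroup.of i)) = if i = j then 1 else 0)
    (hD2 : ∀ (j : Fin (n + 1)) (g g' : FreeGroup (Fin (n + 1))),
      D j (ofF n (g * g')) = D j (ofF n g) + ofF n g * D j (ofF n g'))
    (ρ : FreeGroup (Fin (n + 1)) →* Matrix.SpecialLinearGroup (Fin 2) 𝔽)
    (hρ : ∀ i : Fin n, ρ (r i) = 1)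
    (a : FreeGroup (Fin (n + 1)) →* Multiplicative ℤ)
    (ha : ∀ i : Fin n, a (r i) = 1)
    (Φ : MonoidAlgebra ℤ (FreeGroup (Fin (n + 1))) →+* Matrix (Fin 2) (Fin 2) (RatFunc 𝔽))
    (hΦ : ∀ g : FreeGroup (Fin (n + 1)),
      Φ (ofF n g) = ((RatFunc.X : RatFunc 𝔽) ^ (Multiplicative.toAdd (a g))) •
        ((ρ g : Matrix (Fin 2) (Fin 2) 𝔽).map (algebraMap 𝔽 (RatFunc 𝔽))))
    (j k : Fin (n + 1)) :
    let A : Fin (n + 1) → Matrix (Fin n × Fin 2) (Fin n × Fin 2) (RatFunc 𝔽) :=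
      fun m => Matrix.of fun p q => Φ (D (m.succAbove q.1) (ofF n (r p.1))) p.2 q.2
    (A k).det * (Φ (ofF n (FreeGroup.of j)) - 1).det =
      (A j).det * (Φ (ofF n (FreeGroup.of k)) - 1).det := by
  intro A
  refine det_blockMinor_mul_det (fun i l => Φ (D l (ofF n (r i))))
    (fun l => Φ (ofF n (FreeGroup.of l)) - 1) (fun i => ?_) j k
  have hr : Φ (ofF n (r i)) = 1 := by
    rw [hΦ, hρ, ha]
    simp
  have h := congrArg Φ (sum_fox_mul_sub_one n D hD1 hD2 (r i))
  simpa [hr] using h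
end

section
/- Let X, Y ∈ SL(2, ℂ) be conjugate in SL(2, ℂ) (i.e., Y = Q X Q⁻¹ for some Q ∈ SL(2, ℂ)) and suppose X Y ≠ Y X. Then there exist P ∈ SL(2, ℂ) and complex numbers s ≠ 0 and u such that P X P⁻¹ = [[s, 1], [0, 1/s]] and P Y P⁻¹ = [[s, 0], [u, 1/s]]. -/
open Matrix

/-- The pair `X, Y` is simultaneously conjugate to the pair
`[[s,1],[0,1/s]]`, `[[s,0],[u,1/s]]`. -/
def HasTriangularNormalForm (X Y : Matrix.SpecialLinearGroup (Fin 2) ℂ) : Prop :=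
  ∃ (P : Matrix.SpecialLinearGroup (Fin 2) ℂ) (s u : ℂ), s ≠ 0 ∧
    ((P * X * P⁻¹ : Matrix.SpecialLinearGroup (Fin 2) ℂ) : Matrix (Fin 2) (Fin 2) ℂ) =
      !![s, 1; 0, s⁻¹] ∧
    ((P * Y * P⁻¹ : Matrix.SpecialLinearGroup (Fin 2) ℂ) : Matrix (Fin 2) (Fin 2) ℂ) =
      !![s, 0; u, s⁻¹]

theorem HasTriangularNormalForm.of_conj {X Y : Matrix.SpecialLinearGroup (Fin 2) ℂ}
    (R : Matrix.SpecialLinearGroup (Fin 2) ℂ)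
    (h : HasTriangularNormalForm (R * X * R⁻¹) (R * Y * R⁻¹)) :
    HasTriangularNormalForm X Y := by
  obtain ⟨P, s, u, hs, hX, hY⟩ := h
  have key (Z : Matrix.SpecialLinearGroup (Fin 2) ℂ) :
      P * R * Z * (P * R)⁻¹ = P * (R * Z * R⁻¹) * P⁻¹ := by group
  exact ⟨P * R, s, u, hs, by rw [key, hX], by rw [key, hY]⟩

theorem coe_conj_eq (P X : Matrix.SpecialLinearGroup (Fin 2) ℂ) {p q r t a b c d : ℂ}
    (hP : (P : Matrix (Fin 2) (Fin 2) ℂ) = !![p, q; r, t])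
    (hX : (X : Matrix (Fin 2) (Fin 2) ℂ) = !![a, b; c, d]) :
    ((P * X * P⁻¹ : Matrix.SpecialLinearGroup (Fin 2) ℂ) : Matrix (Fin 2) (Fin 2) ℂ) =
      !![(p * a + q * c) * t - (p * b + q * d) * r, (p * b + q * d) * p - (p * a + q * c) * q;
        (r * a + t * c) * t - (r * b + t * d) * r, (r * b + t * d) * p - (r * a + t * c) * q] := by
  rw [Matrix.SpecialLinearGroup.coe_mul, Matrix.SpecialLinearGroup.coe_mul, Matrix.SpecialLinearGroup.coe_inv, hP, hX,
    adjugate_fin_two_of]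
  ext i j
  fin_cases i <;> fin_cases j <;> simp [Matrix.mul_apply, Fin.sum_univ_two] <;> ring

theorem exists_conj_lower_triangular (Y : Matrix.SpecialLinearGroup (Fin 2) ℂ) :
    ∃ (R : Matrix.SpecialLinearGroup (Fin 2) ℂ) (s u : ℂ), s ≠ 0 ∧
      ((R * Y * R⁻¹ : Matrix.SpecialLinearGroup (Fin 2) ℂ) : Matrix (Fin 2) (Fin 2) ℂ) =
        !![s, 0; u, s⁻¹] := by
  suffices h : ∃ R : Matrix.SpecialLinearGroup (Fin 2) ℂ,
      ((R * Y * R⁻¹ : Matrix.SpecialLinearGroup (Fin 2) ℂ) : Matrix (Fin 2) (Fin 2) ℂ) 0 1 = 0 by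
    obtain ⟨R, hR⟩ := h
    have hdet := (R * Y * R⁻¹).det_coe
    rw [det_fin_two, hR, zero_mul, sub_zero] at hdet
    refine ⟨R, (R * Y * R⁻¹).1 0 0, (R * Y * R⁻¹).1 1 0, left_ne_zero_of_mul_eq_one hdet, ?_⟩
    rw [← eq_inv_of_mul_eq_one_right hdet, ← hR]
    exact eta_fin_two _
  have hY := eta_fin_two Y.1
  by_cases hc : Y.1 1 0 = 0
  · let R : Matrix.SpecialLinearGroup (Fin 2) ℂ := ⟨!![0, 1; -1, 0], by simp [det_fin_two]⟩
    refine ⟨R, ?_⟩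
    rw [coe_conj_eq R Y rfl hY]
    simp [hc]
  · obtain ⟨z, hz⟩ := IsAlgClosed.exists_eq_mul_self
      (discrim (Y.1 1 0) (Y.1 0 0 - Y.1 1 1) (-Y.1 0 1))
    obtain ⟨k, hk⟩ := exists_quadratic_eq_zero hc ⟨z, hz⟩
    let R : Matrix.SpecialLinearGroup (Fin 2) ℂ := ⟨!![1, k; 0, 1], by simp [det_fin_two]⟩
    refine ⟨R, ?_⟩
    rw [coe_conj_eq R Y rfl hY]
    simp only [of_apply, cons_val', cons_val_zero, cons_val_one, cons_val_fin_one]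
    linear_combination -hk

theorem hasTriangularNormalForm_of_lower_triangular {X Y : Matrix.SpecialLinearGroup (Fin 2) ℂ}
    {a b c d s u : ℂ} (hX : (X : Matrix (Fin 2) (Fin 2) ℂ) = !![a, b; c, d])
    (hY : (Y : Matrix (Fin 2) (Fin 2) ℂ) = !![s, 0; u, s⁻¹])
    (hs : s ≠ 0) (hb : b ≠ 0) (htr : a + d = s + s⁻¹) : HasTriangularNormalForm X Y := by
  obtain ⟨r, hr⟩ := IsAlgClosed.exists_pow_nat_eq b⁻¹ (n := 2) two_pos
  have hr0 : r ≠ 0 := by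
    rintro rfl
    simp [hb.symm] at hr
  have hdet : a * d - b * c = 1 := by
    have := X.det_coe
    rwa [hX, det_fin_two_of] at this
  have hd : d = s + s⁻¹ - a := by linear_combination htr
  subst hd
  have hrb : r ^ 2 * b = 1 := by rw [hr, inv_mul_cancel₀ hb]
  let P : Matrix.SpecialLinearGroup (Fin 2) ℂ :=
    ⟨!![r, 0; (a - s) * b⁻¹ * r⁻¹, r⁻¹], by simp [det_fin_two, hr0]⟩
  have hPX := coe_conj_eq P X rfl hX
  have hPY := coe_conj_eq P Y rfl hY
  refine ⟨P, s, (P * Y * P⁻¹).1 1 0, hs, ?_, ?_⟩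
  · rw [hPX]
    ext i j
    fin_cases i <;> fin_cases j <;> simp
    · field_simp; ring
    · linear_combination hrb
    · field_simp
      field_simp at hdet
      linear_combination -hdet
    · field_simp; ring
  · rw [hPY]
    ext i j
    fin_cases i <;> fin_cases j <;> simp
    · field_simp
    · field_simp

theorem trace_conj (P X : Matrix.SpecialLinearGroup (Fin 2) ℂ) :
    ((P * X * P⁻¹ : Matrix.SpecialLinearGroup (Fin 2) ℂ) : Matrix (Fin 2) (Fin 2) ℂ).trace =
      (X : Matrix (Fin 2) (Fin 2) ℂ).trace := by
  rw [Matrix.SpecialLinearGroup.coe_mul, trace_mul_comm, ← Matrix.SpecialLinearGroup.coe_mul,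
    inv_mul_cancel_left]

theorem hasTriangularNormalForm_of_trace_eq {X Y : Matrix.SpecialLinearGroup (Fin 2) ℂ}
    {a b c d s u : ℂ} (hX : (X : Matrix (Fin 2) (Fin 2) ℂ) = !![a, b; c, d])
    (hY : (Y : Matrix (Fin 2) (Fin 2) ℂ) = !![s, 0; u, s⁻¹])
    (hs : s ≠ 0) (htr : a + d = s + s⁻¹) (hcomm : X * Y ≠ Y * X) :
    HasTriangularNormalForm X Y := by
  by_cases hb : b = 0
  swap
  · exact hasTriangularNormalForm_of_lower_triangular hX hY hs hb htr
  subst hb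
  have hdet : a * d = 1 := by
    have := X.det_coe
    rwa [hX, det_fin_two_of, zero_mul, sub_zero] at this
  have hs' : s * s⁻¹ = 1 := mul_inv_cancel₀ hs
  have hne : c * s + d * u ≠ u * a + s⁻¹ * c := by
    contrapose! hcomm
    apply Subtype.ext
    rw [Matrix.SpecialLinearGroup.coe_mul, Matrix.SpecialLinearGroup.coe_mul, hX, hY]
    ext i j
    fin_cases i <;> fin_cases j <;> simp [mul_comm]
    linear_combination hcomm
  have hroot : (a - s) * (a - s⁻¹) = 0 := by
    linear_combination a * htr - hdet + hs'
  have hss : s - s⁻¹ ≠ 0 := by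
    intro h
    have ha : a = s := by
      rw [← sub_eq_zero.mp h] at hroot
      exact sub_eq_zero.mp (mul_self_eq_zero.mp hroot)
    apply hne
    linear_combination c * h + u * (htr - 2 * ha) - u * h
  -- Diagonalise `Y` and exchange its two eigenlines.
  let R : Matrix.SpecialLinearGroup (Fin 2) ℂ :=
    ⟨!![-u / (s - s⁻¹), 1; -1, 0], by simp [det_fin_two]⟩
  have hYR := coe_conj_eq R Y rfl hY
  have hXR := coe_conj_eq R X rfl hX
  refine .of_conj R (hasTriangularNormalForm_of_lower_triangular (s := s⁻¹) (u := 0) hXR ?_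
    (inv_ne_zero hs) ?_ ?_)
  · rw [hYR]
    ext i j
    fin_cases i <;> fin_cases j <;> simp
    linear_combination -div_mul_cancel₀ (-u) hss
  · contrapose! hne
    linear_combination (s⁻¹ - s) * hne + (d - a) * div_mul_cancel₀ (-u) hss
  · rw [inv_inv]
    linear_combination htr

/-- If `X, Y ∈ SL(2,ℂ)` are conjugate in `SL(2,ℂ)` and do not commute, then they can be
simultaneously conjugated to the normal form `[[s,1],[0,1/s]]`, `[[s,0],[u,1/s]]`. -/
theorem conjugate_noncommuting_normal_form
    (X Y : Matrix.SpecialLinearGroup (Fin 2) ℂ)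
    (hconj : ∃ Q : Matrix.SpecialLinearGroup (Fin 2) ℂ, Y = Q * X * Q⁻¹)
    (hcomm : X * Y ≠ Y * X) :
    ∃ (P : Matrix.SpecialLinearGroup (Fin 2) ℂ) (s u : ℂ), s ≠ 0 ∧
      ((P * X * P⁻¹ : Matrix.SpecialLinearGroup (Fin 2) ℂ) : Matrix (Fin 2) (Fin 2) ℂ) =
        !![s, 1; 0, s⁻¹] ∧
      ((P * Y * P⁻¹ : Matrix.SpecialLinearGroup (Fin 2) ℂ) : Matrix (Fin 2) (Fin 2) ℂ) =
        !![s, 0; u, s⁻¹] := by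
  obtain ⟨Q, hQ⟩ := hconj
  obtain ⟨R, s, u, hs, hRY⟩ := exists_conj_lower_triangular Y
  refine HasTriangularNormalForm.of_conj R
    (hasTriangularNormalForm_of_trace_eq (eta_fin_two _) hRY hs ?_ ?_)
  · rw [← trace_fin_two, trace_conj, ← trace_conj Q X, ← hQ, ← trace_conj R Y, hRY,
      trace_fin_two_of]
  · contrapose! hcomm
    exact (MulAut.conj R).injective (by simpa only [map_mul, MulAut.conj_apply] using hcomm)
end

section
/- Let s ∈ ℂ with s ≠ 0 and u ∈ ℂ, and set X = [[s, 1], [0, 1/s]], Y = [[s, 0], [u, 1/s]] ∈ SL(2, ℂ) and W = X⁻¹ Y X Y⁻¹. Then W X = Y W if and only if 3 − 1/s² − s² − 3u + u/s² + s²u + u² = 0. (This equation defines the space of conjugacy classes of irreducible SL(2, ℂ)-representations of the figure-eight knot group ⟨x, y | w x = y w⟩, w = x⁻¹ y x y⁻¹, with x ↦ X and y ↦ Y.) -/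
/-- The defining equation of the space of conjugacy classes of irreducible
`SL(2,ℂ)`-representations of the figure-eight knot group `⟨x, y | wx = yw⟩`,
`w = x⁻¹yxy⁻¹`: with `X = [[s,1],[0,1/s]]`, `Y = [[s,0],[u,1/s]]` and `W = X⁻¹YXY⁻¹`,
one has `WX = YW` iff `3 - 1/s² - s² - 3u + u/s² + s²u + u² = 0`. -/
theorem figure_eight_representation_equation (s u : ℂ) (hs : s ≠ 0) :
    let X : Matrix (Fin 2) (Fin 2) ℂ := !![s, 1; 0, s⁻¹]
    let Y : Matrix (Fin 2) (Fin 2) ℂ := !![s, 0; u, s⁻¹]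
    let W := X⁻¹ * Y * X * Y⁻¹
    W * X = Y * W ↔
      3 - 1 / s ^ 2 - s ^ 2 - 3 * u + u / s ^ 2 + s ^ 2 * u + u ^ 2 = 0 := by
  intro X Y W
  have hX : X⁻¹ = !![s⁻¹, -1; 0, s] := by
    apply Matrix.inv_eq_right_inv
    ext i j
    fin_cases i <;> fin_cases j <;> simp [X, hs]
  have hY : Y⁻¹ = !![s⁻¹, 0; -u, s] := by
    apply Matrix.inv_eq_right_inv
    ext i j
    fin_cases i <;> fin_cases j <;> simp [Y, hs, mul_comm]
  have key : W * X - Y * W =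
      (3 - 1 / s ^ 2 - s ^ 2 - 3 * u + u / s ^ 2 + s ^ 2 * u + u ^ 2) • !![0, 1; -u, 0] := by
    simp only [W, hX, hY]
    ext i j
    fin_cases i <;> fin_cases j <;>
      simp [X, Y] <;> field_simp <;> ring
  rw [← sub_eq_zero, key]
  constructor
  · intro h
    simpa using congrFun (congrFun h 0) 1
  · intro h
    rw [h, zero_smul]
end

section
/- Twisted Alexander polynomial of the (2,q)-torus knot: let q ≥ 3 be odd and b an odd integer with 0 < b < q, and let X, Y ∈ SL(2, ℂ) satisfy tr X = 0 and tr Y = 2 cos(πb/q). Then in ℂ(t): det(I + t^q·X) / det(t²·Y − I) = (t² + 1) · Π_{0 < k < q, k odd, k ≠ b} (t² − ξ_k)(t² − ξ̄_k), where ξ_k = exp(√−1·πk/q) and ξ̄_k = exp(−√−1·πk/q). -/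
set_option synthInstance.maxHeartbeats 400000
set_option maxHeartbeats 1000000

open Polynomial in
/-- Over a `ℂ`-algebra, `s ^ q + 1` splits into the factors attached to the odd powers of
`exp (π i / q)`. -/
theorem pow_add_one_eq_prod_odd {K : Type*} [CommRing K] [Algebra ℂ K] (q : ℕ) (hq : 0 < q)
    (s : K) :
    s ^ q + 1 = ∏ i ∈ Finset.range q,
      (s - algebraMap ℂ K (Complex.exp (((2 * i + 1 : ℕ) : ℂ) * (Real.pi / q * Complex.I)))) := by
  have hq' : (q : ℂ) ≠ 0 := by exact_mod_cast hq.ne'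
  have e : Complex.exp (Real.pi / q * Complex.I) ^ q = -1 := by
    rw [← Complex.exp_nat_mul, ← Complex.exp_pi_mul_I]
    congr 1
    field_simp
  have h := congrArg (aeval s)
    (X_pow_sub_C_eq_prod (Complex.isPrimitiveRoot_exp q hq.ne') hq e)
  simp only [map_sub, map_add, map_pow, aeval_X, aeval_C, map_neg, map_one, map_prod,
    sub_neg_eq_add] at h
  rw [h]
  refine Finset.prod_congr rfl fun i _ => ?_
  rw [← Complex.exp_nat_mul, ← Complex.exp_add]
  congr 3
  push_cast
  ring

/-- The odd numbers below `2 * m + 1` are the `2 * i + 1` with `i < m`. -/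
theorem prod_range_filter_odd {M : Type*} [CommMonoid M] (f : ℕ → M) (m : ℕ) :
    ∏ k ∈ (Finset.range (2 * m + 1)).filter Odd, f k = ∏ i ∈ Finset.range m, f (2 * i + 1) := by
  symm
  refine Finset.prod_bij (fun i _ => 2 * i + 1) ?_ ?_ ?_ fun _ _ => rfl
  · intro i hi
    simp only [Finset.mem_range, Finset.mem_filter] at hi ⊢
    exact ⟨by omega, i, rfl⟩
  · intro i _ j _ h
    omega
  · intro k hk
    simp only [Finset.mem_range, Finset.mem_filter] at hk
    obtain ⟨hk, i, rfl⟩ := hk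
    exact ⟨i, Finset.mem_range.2 (by omega), rfl⟩

/-- For odd `q`, pairing conjugate roots in the factorization of `s ^ q + 1`. -/
theorem pow_add_one_eq_mul_prod_conj {K : Type*} [CommRing K] [Algebra ℂ K] (q : ℕ) (hq : Odd q)
    (s : K) :
    s ^ q + 1 = (s + 1) * ∏ k ∈ (Finset.range q).filter Odd,
      ((s - algebraMap ℂ K (Complex.exp (((Real.pi * k / q : ℝ) : ℂ) * Complex.I))) *
        (s - algebraMap ℂ K (Complex.exp (-((Real.pi * k / q : ℝ) : ℂ) * Complex.I)))) := by
  rw [pow_add_one_eq_prod_odd q hq.pos]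
  have hq' : (q : ℂ) ≠ 0 := by exact_mod_cast hq.pos.ne'
  obtain ⟨m, hm⟩ := hq
  have hmid : Complex.exp (((2 * m + 1 : ℕ) : ℂ) * (Real.pi / q * Complex.I)) = -1 := by
    rw [← hm, ← Complex.exp_pi_mul_I]
    congr 1
    field_simp
  have hsplit : Finset.range q = Finset.range ((m + 1) + m) := by rw [hm]; congr 1; omega
  have hodd : (Finset.range q).filter Odd = (Finset.range (2 * m + 1)).filter Odd := by rw [hm]
  rw [hodd, hsplit, prod_range_filter_odd, Finset.prod_range_add, Finset.prod_range_succ, hmid,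
    Finset.prod_mul_distrib, map_neg, map_one, sub_neg_eq_add, mul_comm _ (s + 1), mul_assoc]
  congr 2
  · refine Finset.prod_congr rfl fun i _ => ?_
    congr 3
    push_cast
    ring
  · rw [← Finset.prod_range_reflect]
    refine Finset.prod_congr rfl fun i hi => ?_
    rw [Finset.mem_range] at hi
    have hidx : ((2 * (m + 1 + (m - 1 - i)) + 1 : ℕ) : ℂ) = 2 * q - (2 * i + 1 : ℕ) := by
      rw [eq_sub_iff_add_eq]
      exact_mod_cast (by omega : 2 * (m + 1 + (m - 1 - i)) + 1 + (2 * i + 1) = 2 * q)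
    rw [hidx, ← Complex.exp_periodic (-_ * Complex.I)]
    congr 3
    push_cast
    field_simp
    ring

theorem det_one_add_smul_fin_two {K : Type*} [CommRing K] (c : K) (M : Matrix (Fin 2) (Fin 2) K) :
    (1 + c • M).det = 1 + c * M.trace + c ^ 2 * M.det := by
  simp [Matrix.det_fin_two, Matrix.trace_fin_two]
  ring

theorem det_smul_sub_one_fin_two {K : Type*} [CommRing K] (c : K)
    (M : Matrix (Fin 2) (Fin 2) K) :
    (c • M - 1).det = c ^ 2 * M.det - c * M.trace + 1 := by
  simp [Matrix.det_fin_two, Matrix.trace_fin_two]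
  ring

/-- The quadratic with roots `exp (± i θ)`. -/
theorem sub_exp_mul_sub_exp_neg {K : Type*} [CommRing K] [Algebra ℂ K] (s : K) (θ : ℝ) :
    (s - algebraMap ℂ K (Complex.exp ((θ : ℂ) * Complex.I))) *
        (s - algebraMap ℂ K (Complex.exp (-(θ : ℂ) * Complex.I))) =
      s ^ 2 - s * algebraMap ℂ K ((2 * Real.cos θ : ℝ) : ℂ) + 1 := by
  have hsum : ((2 * Real.cos θ : ℝ) : ℂ) =
      Complex.exp ((θ : ℂ) * Complex.I) + Complex.exp (-(θ : ℂ) * Complex.I) := by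
    push_cast
    exact Complex.two_cos _
  have hmul : algebraMap ℂ K (Complex.exp ((θ : ℂ) * Complex.I)) *
      algebraMap ℂ K (Complex.exp (-(θ : ℂ) * Complex.I)) = 1 := by
    rw [← map_mul, ← Complex.exp_add]
    simp
  rw [hsum, map_add]
  linear_combination hmul

/-- `t ^ 2` is not a constant of `ℂ(t)`. -/
theorem RatFunc.X_sq_sub_algebraMap_ne_zero (a : ℂ) :
    (RatFunc.X : RatFunc ℂ) ^ 2 - algebraMap ℂ (RatFunc ℂ) a ≠ 0 := by
  have h : (RatFunc.X : RatFunc ℂ) ^ 2 - algebraMap ℂ (RatFunc ℂ) a =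
      algebraMap (Polynomial ℂ) (RatFunc ℂ) (Polynomial.X ^ 2 - Polynomial.C a) := by
    simp [RatFunc.algebraMap_eq_C]
  rw [h]
  exact RatFunc.algebraMap_ne_zero (Polynomial.X_pow_sub_C_ne_zero two_pos a)

/-- The twisted Alexander polynomial of the `(2,q)`-torus knot for the irreducible
representation on the component indexed by the odd integer `b` (`0 < b < q`):
`det(I + t^q X)/det(t² Y - I) = (t² + 1) Π_{0<k<q, k odd, k≠b} (t² - ξ_k)(t² - ξ̄_k)`,
where `ξ_k = exp(√-1 π k/q)`. -/
theorem torus_two_q_twisted_alexander (q : ℕ) (hq3 : 3 ≤ q) (hq : Odd q)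
    (b : ℕ) (hbodd : Odd b) (hb0 : 0 < b) (hbq : b < q)
    (X Y : Matrix.SpecialLinearGroup (Fin 2) ℂ)
    (htrX : Matrix.trace (X : Matrix (Fin 2) (Fin 2) ℂ) = 0)
    (htrY : Matrix.trace (Y : Matrix (Fin 2) (Fin 2) ℂ) =
      ((2 * Real.cos (Real.pi * b / q) : ℝ) : ℂ)) :
    let t : RatFunc ℂ := RatFunc.X
    let φ : Matrix (Fin 2) (Fin 2) ℂ → Matrix (Fin 2) (Fin 2) (RatFunc ℂ) :=
      fun M => M.map (algebraMap ℂ (RatFunc ℂ))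
    let ξ : ℕ → RatFunc ℂ := fun k =>
      algebraMap ℂ (RatFunc ℂ) (Complex.exp (((Real.pi * k / q : ℝ) : ℂ) * Complex.I))
    let ξbar : ℕ → RatFunc ℂ := fun k =>
      algebraMap ℂ (RatFunc ℂ) (Complex.exp (-((Real.pi * k / q : ℝ) : ℂ) * Complex.I))
    (1 + t ^ q • φ (X : Matrix (Fin 2) (Fin 2) ℂ)).det /
        (t ^ 2 • φ (Y : Matrix (Fin 2) (Fin 2) ℂ) - 1).det =
      (t ^ 2 + 1) *
        ∏ k ∈ (Finset.range q).filter (fun k => Odd k ∧ k ≠ b),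
          ((t ^ 2 - ξ k) * (t ^ 2 - ξbar k)) := by
  intro t φ ξ ξbar
  have hdetφ (M : Matrix (Fin 2) (Fin 2) ℂ) :
      (φ M).det = algebraMap ℂ (RatFunc ℂ) M.det :=
    ((algebraMap ℂ (RatFunc ℂ)).map_det M).symm
  have htrφ (M : Matrix (Fin 2) (Fin 2) ℂ) :
      (φ M).trace = algebraMap ℂ (RatFunc ℂ) M.trace := by
    simp [φ, Matrix.trace_fin_two]
  have hnum : (1 + t ^ q • φ X).det = (t ^ 2) ^ q + 1 := by
    rw [det_one_add_smul_fin_two, hdetφ, X.det_coe, htrφ, htrX, map_zero, map_one]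
    ring
  have hden : (t ^ 2 • φ Y - 1).det = (t ^ 2 - ξ b) * (t ^ 2 - ξbar b) := by
    rw [det_smul_sub_one_fin_two, hdetφ, Y.det_coe, map_one, htrφ, htrY, mul_one]
    exact (sub_exp_mul_sub_exp_neg _ _).symm
  have hb : b ∈ (Finset.range q).filter Odd := by simp [hbq, hbodd]
  have herase : (Finset.range q).filter (fun k => Odd k ∧ k ≠ b) =
      ((Finset.range q).filter Odd).erase b := by
    ext k
    simp only [Finset.mem_filter, Finset.mem_erase]
    tauto
  have hne : (t ^ 2 - ξ b) * (t ^ 2 - ξbar b) ≠ 0 :=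
    mul_ne_zero (RatFunc.X_sq_sub_algebraMap_ne_zero _) (RatFunc.X_sq_sub_algebraMap_ne_zero _)
  rw [hnum, hden, herase, div_eq_iff hne, mul_assoc, Finset.prod_erase_mul _ _ hb]
  exact pow_add_one_eq_mul_prod_conj q hq (t ^ 2)
end
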